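/- Let r ≥ 1, χ : {1,…,r} → {0,1}, A ∈ GL_r(ℝ), x, y ∈ (0,1)^r, and let G : ℂ^r → ℂ be any holomorphic function on all of ℂ^r satisfying G(s) = L_χ(s, A, x, y) whenever Re s_ν > 0 for all ν. Then for every k = (k_1,…,k_r) ∈ ℤ_{≥0}^r: G(−k) = B_k(A, x, y) if k_ν ≡ 1 − χ(ν) (mod 2) for every ν, and G(−k) = 0 otherwise. -/

import Mathlib

open MeasureTheory

noncomputable section

/-- `e z = exp (2 π i z)` -/
def eC (z : ℂ) : ℂ := Complex.exp (2 * Real.pi * Complex.I * z)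

/-- `φ(t,x,y) = e(itx)/(1 - e(y + it))` -/
def phiF (t x y : ℝ) : ℂ := eC (Complex.I * t * x) / (1 - eC (y + Complex.I * t))

/-- `F(t,x,y) = ∏_ν φ(t_ν, x_ν, y_ν)` -/
def FF {r : ℕ} (t x y : Fin r → ℝ) : ℂ := ∏ ν, phiF (t ν) (x ν) (y ν)

/-- `Γ_ℝ(s) = π^(-s/2) Γ(s/2)` -/
def GammaR (s : ℂ) : ℂ := (Real.pi : ℂ) ^ (-s / 2) * Complex.Gamma (s / 2)

/-- `Γ_ℂ(s) = 2 (2π)^(-s) Γ(s)` -/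
def GammaC (s : ℂ) : ℂ := 2 * (2 * (Real.pi : ℂ)) ^ (-s) * Complex.Gamma s

/-- the quasi-character `|t|_χ^s = ∏_ν sgn(t_ν)^{χ(ν)} |t_ν|^{s_ν}` -/
def qchar {r : ℕ} (χ : Fin r → ℕ) (s : Fin r → ℂ) (t : Fin r → ℝ) : ℂ :=
  ∏ ν, ((Real.sign (t ν) : ℂ)) ^ (χ ν) * ((|t ν| : ℝ) : ℂ) ^ (s ν)

/-- the Shintani L-function, defined by the integral representation
`L(s,A,x,y) = 2^r (∏ Γ_ℂ(s_ν))⁻¹ ∫_{(0,∞)^r} F(tA,x,y) t^s ∏ dt_ν/t_ν` -/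
def ShintaniL {r : ℕ} (s : Fin r → ℂ) (A : Matrix (Fin r) (Fin r) ℝ)
    (x y : Fin r → ℝ) : ℂ :=
  2 ^ r * (∏ ν, GammaC (s ν))⁻¹ *
    ∫ t in Set.univ.pi fun _ : Fin r => Set.Ioi (0 : ℝ),
      FF (Matrix.vecMul t A) x y * ∏ ν, (((t ν : ℝ) : ℂ) ^ (s ν) * ((t ν : ℝ) : ℂ)⁻¹)

/-- the normalized Shintani L-function of parity type χ,
`L_χ(s,A,x,y) = (∏ Γ_ℂ(s_ν))⁻¹ ∫_{(ℝ^×)^r} F(tA,x,y) |t|_χ^s ∏ dt_ν/t_ν` -/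
def ShintaniLchi {r : ℕ} (χ : Fin r → ℕ) (s : Fin r → ℂ)
    (A : Matrix (Fin r) (Fin r) ℝ) (x y : Fin r → ℝ) : ℂ :=
  (∏ ν, GammaC (s ν))⁻¹ *
    ∫ t : Fin r → ℝ,
      FF (Matrix.vecMul t A) x y * qchar χ s t * ∏ ν, ((t ν : ℝ) : ℂ)⁻¹

/-- `Γ_χ(s) = ∏_ν Γ_ℝ(s_ν + χ(ν))` -/
def GammaChi {r : ℕ} (χ : Fin r → ℕ) (s : Fin r → ℂ) : ℂ :=
  ∏ ν, GammaR (s ν + (χ ν : ℂ))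

/-- the completed normalized Shintani L-function
`L̂_χ(s,A,x,y) = |det A|^{1/2} Γ_χ(s) L_χ(s,A,x,y)` -/
def ShintaniLhat {r : ℕ} (χ : Fin r → ℕ) (s : Fin r → ℂ)
    (A : Matrix (Fin r) (Fin r) ℝ) (x y : Fin r → ℝ) : ℂ :=
  ((Real.sqrt |A.det| : ℝ) : ℂ) * GammaChi χ s * ShintaniLchi χ s A x y


/-- the partial derivative in the ν-th coordinate -/
def pder {r : ℕ} (ν : Fin r) (g : (Fin r → ℝ) → ℂ) : (Fin r → ℝ) → ℂ :=
  fun t => deriv (fun u : ℝ => g (Function.update t ν u)) (t ν)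

/-- the iterated partial derivative `∂_{t_1}^{k_1} ⋯ ∂_{t_r}^{k_r}` -/
def pderMulti {r : ℕ} (k : Fin r → ℕ) (g : (Fin r → ℝ) → ℂ) : (Fin r → ℝ) → ℂ :=
  (List.finRange r).foldr (fun ν h => (pder ν)^[k ν] h) g

/-- the multiple Bernoulli-like numbers
`B_k(A,x,y) = (-2π)^{-(k_1+⋯+k_r)} ∂^k F(tA,x,y)|_{t=0}` -/
def BkNum {r : ℕ} (A : Matrix (Fin r) (Fin r) ℝ) (x y : Fin r → ℝ)
    (k : Fin r → ℕ) : ℂ :=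
  ((-2 * (Real.pi : ℂ)) ^ (∑ ν, k ν))⁻¹ *
    pderMulti k (fun t => FF (Matrix.vecMul t A) x y) 0

open Filter Topology Set in
theorem ml_conv {f : ℝ → ℂ} (hc : Continuous f) {C c : ℝ} (hc0 : 0 < c)
    (hb : ∀ u, 0 ≤ u → ‖f u‖ ≤ C * Real.exp (-c * u)) {s : ℂ} (hs : 0 < s.re) :
    MellinConvergent f s ∧ DifferentiableAt ℂ (mellin f) s := by
  have h1 : LocallyIntegrableOn f (Ioi 0) := hc.locallyIntegrable.locallyIntegrableOn _
  have h2 : f =O[atTop] fun t => Real.exp (-c * t) := by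
    apply Asymptotics.IsBigO.of_bound C
    filter_upwards [eventually_ge_atTop 0] with u hu
    simpa [abs_of_pos (Real.exp_pos _)] using hb u hu
  have h3 : f =O[𝓝[>] 0] (fun t : ℝ => t ^ (-(0:ℝ))) := by
    simp only [neg_zero, Real.rpow_zero]
    exact ((hc.continuousAt (x := 0)).isBigO_one ℝ).mono nhdsWithin_le_nhds
  exact ⟨mellinConvergent_of_isBigO_rpow_exp hc0 h1 h2 h3 hs,
    mellin_differentiableAt_of_isBigO_rpow_exp hc0 h1 h2 h3 hs⟩

open Filter Topology Set in
theorem ml_step {f f' : ℝ → ℂ} (hd : ∀ u, HasDerivAt f (f' u) u) (hc' : Continuous f')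
    {C c : ℝ} (hc0 : 0 < c)
    (hb : ∀ u, 0 ≤ u → ‖f u‖ ≤ C * Real.exp (-c * u))
    {C' c' : ℝ} (hc0' : 0 < c')
    (hb' : ∀ u, 0 ≤ u → ‖f' u‖ ≤ C' * Real.exp (-c' * u))
    {s : ℂ} (hs : 0 < s.re) :
    s * mellin f s = - mellin f' (s + 1) := by
  have hc : Continuous f := continuous_iff_continuousAt.2 fun u => (hd u).continuousAt
  have i1 := (ml_conv hc hc0 hb hs).1
  have i2 := (ml_conv (s := s + 1) hc' hc0' hb' (by simp; linarith)).1
  have hs0 : s ≠ 0 := by rintro rfl; simp at hs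
  have key := integral_Ioi_mul_deriv_eq_deriv_mul (a := (0:ℝ)) (u := fun t : ℝ => (t:ℂ) ^ s)
    (u' := fun t : ℝ => s * (t:ℂ) ^ (s - 1)) (v := f) (v' := f') (a' := 0) (b' := 0)
    (fun t ht => by
      exact hasDerivAt_ofReal_cpow_const (x := t) (r := s) (ne_of_gt ht) hs0)
    (fun t _ => hd t) (by
      have := i2
      simp only [MellinConvergent, add_sub_cancel_right, smul_eq_mul] at this
      exact this) (by
      have := i1.const_smul s
      refine this.congr ?_
      filter_upwards with t
      simp [smul_eq_mul]; ring) (by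
      have : Tendsto (fun t : ℝ => (t:ℂ) ^ s * f t) (𝓝 0) (𝓝 (((0:ℝ):ℂ) ^ s * f 0)) := by
        apply Tendsto.mul
        · exact (Complex.continuousAt_ofReal_cpow_const 0 s (Or.inl hs)).tendsto
        · exact (hc.tendsto 0)
      simp [hs0] at this
      exact this.mono_left nhdsWithin_le_nhds) (by
      rw [tendsto_zero_iff_norm_tendsto_zero]
      have h0 : Tendsto (fun t : ℝ => C * (t ^ s.re * Real.exp (-c * t))) atTop (𝓝 0) := by
        simpa using (tendsto_rpow_mul_exp_neg_mul_atTop_nhds_zero s.re c hc0).const_mul C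
      refine squeeze_zero' (Eventually.of_forall fun t => norm_nonneg _) ?_ h0
      filter_upwards [eventually_gt_atTop 0] with t ht
      simp only [Pi.mul_apply, norm_mul, Complex.norm_cpow_eq_rpow_re_of_pos ht]
      have := hb t ht.le
      have h2 := Real.rpow_nonneg ht.le s.re
      nlinarith)
  rw [mellin, mellin]
  simp only [smul_eq_mul, add_sub_cancel_right]
  rw [key, ← integral_const_mul]
  simp [mul_assoc]

open Filter Topology Set in
theorem ml_one {f f' : ℝ → ℂ} (hd : ∀ u, HasDerivAt f (f' u) u) (hc' : Continuous f')
    {C c : ℝ} (hc0 : 0 < c)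
    (hb : ∀ u, 0 ≤ u → ‖f u‖ ≤ C * Real.exp (-c * u))
    {C' c' : ℝ} (hc0' : 0 < c')
    (hb' : ∀ u, 0 ≤ u → ‖f' u‖ ≤ C' * Real.exp (-c' * u)) :
    mellin f' 1 = - f 0 := by
  have i2 := (ml_conv (s := 1) hc' hc0' hb' (by simp)).1
  have := integral_Ioi_of_hasDerivAt_of_tendsto' (a := (0:ℝ)) (f := f) (f' := f') (m := 0)
    (fun u _ => hd u) (by simpa [MellinConvergent] using i2) (by
      rw [tendsto_zero_iff_norm_tendsto_zero]
      have h0 : Tendsto (fun t : ℝ => C * (t ^ (0:ℝ) * Real.exp (-c * t))) atTop (𝓝 0) := by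
        simpa using (tendsto_rpow_mul_exp_neg_mul_atTop_nhds_zero 0 c hc0).const_mul C
      refine squeeze_zero' (Eventually.of_forall fun t => norm_nonneg _) ?_ h0
      filter_upwards [eventually_gt_atTop 0] with t ht
      simpa using hb t ht.le)
  simp [mellin, this]

theorem ml_iter {f : ℕ → ℝ → ℂ} (hd : ∀ j u, HasDerivAt (f j) (f (j + 1) u) u)
    (hb : ∀ j, ∃ C c : ℝ, 0 < c ∧ ∀ u, 0 ≤ u → ‖f j u‖ ≤ C * Real.exp (-c * u))
    {s : ℂ} (hs : 0 < s.re) (n : ℕ) :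
    (Complex.Gamma s)⁻¹ * mellin (f 0) s =
      (-1) ^ n * (Complex.Gamma (s + n))⁻¹ * mellin (f n) (s + n) := by
  induction n with
  | zero => simp
  | succ n ih =>
    have hc : ∀ j, Continuous (f j) :=
      fun j => continuous_iff_continuousAt.2 fun u => (hd j u).continuousAt
    obtain ⟨C, c, hc0, hb1⟩ := hb n
    obtain ⟨C', c', hc0', hb1'⟩ := hb (n + 1)
    have hs' : 0 < (s + n).re := by simp; positivity
    have h := ml_step (hd n) (hc (n + 1)) hc0 hb1 hc0' hb1' hs'
    have hne : s + n ≠ 0 := by intro h0; rw [h0] at hs'; simp at hs'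
    have hG := Complex.Gamma_add_one (s + n) hne
    rw [ih]
    push_cast
    rw [← add_assoc, hG]
    have h' : mellin (f (n + 1)) (s + n + 1) = - ((s + n) * mellin (f n) (s + n)) := by
      rw [h]; ring
    rw [h']
    have hGn := Complex.Gamma_ne_zero_of_re_pos hs'
    field_simp
    ring

open Filter Topology Set in
theorem ml_value {f : ℕ → ℝ → ℂ} (hd : ∀ j u, HasDerivAt (f j) (f (j + 1) u) u)
    (hb : ∀ j, ∃ C c : ℝ, 0 < c ∧ ∀ u, 0 ≤ u → ‖f j u‖ ≤ C * Real.exp (-c * u))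
    {E : ℂ → ℂ} (hE : Differentiable ℂ E)
    (h : ∀ s : ℂ, 0 < s.re → E s = (Complex.Gamma s)⁻¹ * mellin (f 0) s) (k : ℕ) :
    E (-(k:ℂ)) = (-1) ^ k * f k 0 := by
  have hc : ∀ j, Continuous (f j) :=
    fun j => continuous_iff_continuousAt.2 fun u => (hd j u).continuousAt
  obtain ⟨C, c, hc0, hb1⟩ := hb k
  obtain ⟨C', c', hc0', hb1'⟩ := hb (k + 1)
  let U : Set ℂ := {z | -((k:ℝ) + 1) < z.re}
  have hU : IsOpen U := isOpen_lt continuous_const Complex.continuous_re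
  let H : ℂ → ℂ := fun s => (-1) ^ (k + 1) * (Complex.Gamma (s + (k + 1 : ℕ)))⁻¹ *
    mellin (f (k + 1)) (s + (k + 1 : ℕ))
  have hH : DifferentiableOn ℂ H U := by
    intro z hz
    apply DifferentiableAt.differentiableWithinAt
    have hz' : 0 < (z + (k + 1 : ℕ)).re := by
      simp only [U, mem_ofPred_eq] at hz
      simp; linarith
    have d1 : DifferentiableAt ℂ (fun s : ℂ => mellin (f (k + 1)) (s + (k + 1 : ℕ))) z :=
      DifferentiableAt.comp (f := fun s : ℂ => s + (k + 1 : ℕ)) z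
        (ml_conv (hc (k + 1)) hc0' hb1' hz').2 (by fun_prop)
    have d2 : DifferentiableAt ℂ (fun s : ℂ => (Complex.Gamma (s + (k + 1 : ℕ)))⁻¹) z :=
      DifferentiableAt.comp (f := fun s : ℂ => s + (k + 1 : ℕ)) z
        (Complex.differentiable_one_div_Gamma _) (by fun_prop)
    exact (d2.const_mul _).mul d1
  have hconv : Convex ℝ U := convex_halfSpace_re_gt _
  have heq : EqOn E H U := by
    apply AnalyticOnNhd.eqOn_of_preconnected_of_eventuallyEq (z₀ := 1)
      (hE.differentiableOn.analyticOnNhd hU) (hH.analyticOnNhd hU) hconv.isPreconnected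
    · simp only [U, mem_ofPred_eq, Complex.one_re]; linarith [(Nat.cast_nonneg k : (0:ℝ) ≤ k)]
    · have : ∀ᶠ z : ℂ in 𝓝 1, 0 < z.re :=
        (isOpen_lt continuous_const Complex.continuous_re).mem_nhds (by simp)
      filter_upwards [this] with z hz
      rw [h z hz, ml_iter hd hb hz (k + 1)]
  have hk : (-(k:ℂ)) ∈ U := by simp [U]
  rw [heq hk]
  simp only [H]
  have e1 : (-(k:ℂ) + (k + 1 : ℕ)) = 1 := by push_cast; ring
  rw [e1, ml_one (hd k) (hc (k+1)) hc0 hb1 hc0' hb1']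
  simp [pow_succ]

/-- one-dimensional weight -/
def wt (a : ℕ) (s : ℂ) (t : ℝ) : ℂ :=
  (Real.sign t : ℂ) ^ a * ((|t| : ℝ) : ℂ) ^ s * (t : ℂ)⁻¹

theorem wt_meas (a : ℕ) (s : ℂ) : Measurable (wt a s) := by
  unfold wt
  have : Measurable Real.sign := by
    unfold Real.sign
    refine Measurable.ite (measurableSet_lt measurable_id measurable_const) measurable_const ?_
    exact Measurable.ite (measurableSet_lt measurable_const measurable_id) measurable_const
      measurable_const
  have h2 : Measurable fun t : ℝ => |t| := continuous_abs.measurable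
  exact (((Complex.measurable_ofReal.comp this).pow_const a).mul
    ((Complex.measurable_ofReal.comp h2).pow_const s)).mul (Complex.measurable_ofReal.inv)

theorem wt_pos (a : ℕ) (s : ℂ) {t : ℝ} (ht : 0 < t) : wt a s t = (t:ℂ) ^ (s - 1) := by
  have : (t:ℂ) ≠ 0 := by exact_mod_cast ht.ne'
  rw [wt, Real.sign_of_pos ht, abs_of_pos ht, Complex.cpow_sub _ _ this]
  simp [div_eq_mul_inv]

theorem wt_neg (a : ℕ) (s : ℂ) {t : ℝ} (ht : 0 < t) :
    wt a s (-t) = - ((-1) ^ a * (t:ℂ) ^ (s - 1)) := by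
  have : (t:ℂ) ≠ 0 := by exact_mod_cast ht.ne'
  rw [wt, Real.sign_of_neg (by linarith), abs_neg, abs_of_pos ht, Complex.cpow_sub _ _ this]
  simp [div_eq_mul_inv, mul_assoc]

/-- splitting an integral over the line -/
theorem int_of_half {f : ℝ → ℂ} (h1 : IntegrableOn f (Set.Ioi 0))
    (h2 : IntegrableOn (fun t => f (-t)) (Set.Ioi 0)) :
    Integrable f ∧ ∫ t, f t = ∫ t in Set.Ioi (0:ℝ), (f t + f (-t)) := by
  have h3 : IntegrableOn f (Set.Iic 0) := by
    rw [integrableOn_Iic_iff_integrableOn_Iio,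
      ← (Measure.measurePreserving_neg (volume : Measure ℝ)).integrableOn_comp_preimage
      (Homeomorph.neg ℝ).measurableEmbedding]
    simpa [Function.comp_def] using h2
  refine ⟨?_, ?_⟩
  · rw [← integrableOn_univ, ← @Set.Iic_union_Ioi _ _ (0:ℝ)]
    exact h3.union h1
  · rw [integral_add h1 h2, integral_comp_neg_Ioi, neg_zero, add_comm,
      intervalIntegral.integral_Iic_add_Ioi h3 h1]

theorem wt_int {c : ℝ} (hc : 0 < c) (a : ℕ) {s : ℂ} (hs : 0 < s.re) :
    Integrable (fun t : ℝ => (Real.exp (-c * |t|) : ℂ) * wt a s t) := by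
  have hm : Continuous (fun t : ℝ => (Real.exp (-c * t) : ℂ)) := by fun_prop
  have := (ml_conv (C := 1) (s := s) hm hc (by
    intro u hu; rw [Complex.norm_real, Real.norm_of_nonneg (Real.exp_pos _).le, one_mul]) hs).1
  rw [MellinConvergent] at this
  refine (int_of_half ?_ ?_).1
  · refine this.congr_fun ?_ measurableSet_Ioi
    intro t ht
    simp only [wt_pos a s ht, abs_of_pos (Set.mem_Ioi.1 ht), smul_eq_mul]
    ring
  · refine IntegrableOn.congr_fun (Integrable.const_mul this (-(-1) ^ a)) ?_ measurableSet_Ioi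
    intro t ht
    simp only [wt_neg a s ht, abs_neg, abs_of_pos (Set.mem_Ioi.1 ht), smul_eq_mul]
    ring

/-- parity/normalisation constant -/
def cst (a k : ℕ) : ℂ := (1 - (-1) ^ (a + k)) / 2 * ((-2 * (Real.pi : ℂ)) ^ k)⁻¹

theorem one_dim {f : ℕ → ℝ → ℂ} (hd : ∀ j u, HasDerivAt (f j) (f (j + 1) u) u)
    (hb : ∀ j, ∃ C c : ℝ, 0 < c ∧ ∀ u, ‖f j u‖ ≤ C * Real.exp (-c * |u|))
    {E : ℂ → ℂ} (hE : Differentiable ℂ E) (a : ℕ)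
    (h : ∀ s : ℂ, 0 < s.re → E s = (GammaC s)⁻¹ * ∫ t, f 0 t * wt a s t) (k : ℕ) :
    E (-(k:ℂ)) = cst a k * f k 0 := by
  have hc : ∀ j, Continuous (f j) :=
    fun j => continuous_iff_continuousAt.2 fun u => (hd j u).continuousAt
  let g : ℕ → ℝ → ℂ := fun j u => f j u - (-1) ^ (a + j) * f j (-u)
  have gd : ∀ j u, HasDerivAt (g j) (g (j + 1) u) u := by
    intro j u
    have h1 := HasDerivAt.scomp u (hd j (-u)) (hasDerivAt_neg u)
    have := (hd j u).sub (h1.const_mul ((-1) ^ (a + j)))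
    refine this.congr_deriv ?_
    simp [g, pow_succ, ← add_assoc]
  have gb : ∀ j, ∃ C c : ℝ, 0 < c ∧ ∀ u, 0 ≤ u → ‖g j u‖ ≤ C * Real.exp (-c * u) := by
    intro j
    obtain ⟨C, c, hc, hb⟩ := hb j
    refine ⟨2 * C, c, hc, fun u hu => ?_⟩
    have h1 := hb u
    have h2 := hb (-u)
    rw [abs_neg] at h2
    rw [abs_of_nonneg hu] at h1 h2
    calc ‖g j u‖ ≤ ‖f j u‖ + ‖(-1) ^ (a + j) * f j (-u)‖ := norm_sub_le _ _
      _ ≤ _ := by rw [norm_mul, norm_pow, norm_neg, norm_one, one_pow]; linarith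
  have hpi : (2 * (Real.pi:ℂ)) ≠ 0 := by simp [Real.pi_ne_zero]
  have key := ml_value gd gb (E := fun z => 2 * (2 * (Real.pi : ℂ)) ^ (-z) * E z) (by
    intro z
    have : DifferentiableAt ℂ (fun z : ℂ => (2 * (Real.pi:ℂ)) ^ (-z)) z :=
      DifferentiableAt.const_cpow (by fun_prop) (Or.inl hpi)
    exact (this.const_mul 2).mul (hE z)) (by
    intro s hs
    rw [h s hs]
    obtain ⟨C, c, hc0, hb⟩ := hb 0
    have m1 := (ml_conv (s := s) (hc 0) hc0 (C := C)
      (by intro u hu; have := hb u; rwa [abs_of_nonneg hu] at this) hs).1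
    have m2 := (ml_conv (s := s) (f := fun u => f 0 (-u)) ((hc 0).comp continuous_neg) hc0 (C := C)
      (by intro u hu; have := hb (-u); rwa [abs_neg, abs_of_nonneg hu] at this) hs).1
    have := (int_of_half (f := fun t => f 0 t * wt a s t) (by
        refine m1.congr_fun ?_ measurableSet_Ioi
        intro t ht
        simp only [wt_pos a s ht, smul_eq_mul]
        ring) (by
        refine IntegrableOn.congr_fun (Integrable.const_mul m2 (-(-1) ^ a)) ?_ measurableSet_Ioi
        intro t ht
        simp only [wt_neg a s ht, smul_eq_mul]
        ring)).2
    rw [this, mellin]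
    have e : ∫ t in Set.Ioi (0:ℝ), (f 0 t * wt a s t + f 0 (-t) * wt a s (-t)) =
        ∫ t in Set.Ioi (0:ℝ), (t:ℂ) ^ (s - 1) • g 0 t := by
      apply setIntegral_congr_fun measurableSet_Ioi
      intro t ht
      simp only [wt_pos a s ht, wt_neg a s ht, smul_eq_mul, g]
      ring
    rw [e, GammaC]
    have : (2 * (Real.pi:ℂ)) ^ (-s) ≠ 0 := by simp [Complex.cpow_eq_zero_iff, Real.pi_ne_zero]
    field_simp) k
  simp only [neg_neg, Complex.cpow_natCast, g, neg_zero] at key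
  rw [cst]
  have e : E (-(k:ℂ)) = (2 * (2 * (Real.pi:ℂ)) ^ k)⁻¹ *
      (2 * (2 * (Real.pi:ℂ)) ^ k * E (-(k:ℂ))) := by
    field_simp
  rw [e, key]
  have e2 : ((-2 * (Real.pi:ℂ)) ^ k)⁻¹ = (-1) ^ k * ((2 * (Real.pi:ℂ)) ^ k)⁻¹ := by
    rw [show (-2 * (Real.pi:ℂ)) = (-1) * (2 * Real.pi) by ring, mul_pow, mul_inv, ← inv_pow]
    norm_num
  rw [e2, mul_inv]
  ring

/-- a class of smooth, exponentially decaying functions -/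
def Nice {n : ℕ} (g : (Fin n → ℝ) → ℂ) : Prop :=
  ∃ S : Set ((Fin n → ℝ) → ℂ), g ∈ S ∧ ∀ h ∈ S, Differentiable ℝ h ∧
    (∃ C c : ℝ, 0 < c ∧ ∀ t, ‖h t‖ ≤ C * ∏ i, Real.exp (-c * |t i|)) ∧ ∀ ν, pder ν h ∈ S

theorem Nice.diff {n : ℕ} {g : (Fin n → ℝ) → ℂ} (h : Nice g) : Differentiable ℝ g := by
  obtain ⟨S, hg, hS⟩ := h
  exact (hS g hg).1

theorem Nice.bound {n : ℕ} {g : (Fin n → ℝ) → ℂ} (h : Nice g) :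
    ∃ C c : ℝ, 0 < c ∧ ∀ t, ‖g t‖ ≤ C * ∏ i, Real.exp (-c * |t i|) := by
  obtain ⟨S, hg, hS⟩ := h
  exact (hS g hg).2.1

theorem Nice.pder {n : ℕ} {g : (Fin n → ℝ) → ℂ} (h : Nice g) (ν : Fin n) :
    Nice (pder ν g) := by
  obtain ⟨S, hg, hS⟩ := h
  exact ⟨S, (hS g hg).2.2 ν, hS⟩

theorem Nice.iter {n : ℕ} {g : (Fin n → ℝ) → ℂ} (h : Nice g) (ν : Fin n) (j : ℕ) :
    Nice ((_root_.pder ν)^[j] g) := by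
  induction j with
  | zero => simpa using h
  | succ j ih => rw [Function.iterate_succ_apply']; exact ih.pder ν

/-- append a last coordinate -/
abbrev sn {β : Type} {n : ℕ} (t : Fin n → β) (u : β) : Fin (n + 1) → β :=
  Fin.snoc (α := fun _ => β) t u

theorem pder_slice {n : ℕ} (h : (Fin (n + 1) → ℝ) → ℂ) (c : ℂ) (u : ℝ) (ν : Fin n) :
    pder ν (fun t => c * h (sn t u)) = fun t => c * pder ν.castSucc h (sn t u) := by
  funext t
  simp only [pder, sn, Fin.snoc_update, Fin.snoc_castSucc]
  rw [deriv_const_mul_field]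

theorem sn_diff {n : ℕ} (u : ℝ) : Differentiable ℝ (fun t : Fin n → ℝ => sn t u) := by
  rw [differentiable_pi]
  intro i
  refine Fin.lastCases ?_ (fun i => ?_) i
  · simp [sn]
  · simp only [sn, Fin.snoc_castSucc]; fun_prop

theorem sn_diff2 {n : ℕ} (t : Fin n → ℝ) : Differentiable ℝ (fun u : ℝ => sn t u) := by
  rw [differentiable_pi]
  intro i
  refine Fin.lastCases ?_ (fun i => ?_) i
  · simp [sn]
  · simp [sn, Fin.snoc_castSucc]

theorem Nice.slice {n : ℕ} {g : (Fin (n + 1) → ℝ) → ℂ} (h : Nice g) (c : ℂ) (u : ℝ) :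
    Nice (fun t => c * g (sn t u)) := by
  obtain ⟨S, hg, hS⟩ := h
  refine ⟨(fun (h : (Fin (n + 1) → ℝ) → ℂ) => fun t => c * h (sn t u)) '' S, ⟨g, hg, rfl⟩, ?_⟩
  rintro _ ⟨h, hh, rfl⟩
  obtain ⟨h1, ⟨C, d, hd, hb⟩, h3⟩ := hS h hh
  refine ⟨?_, ⟨‖c‖ * C * Real.exp (-d * |u|), d, hd, fun t => ?_⟩, fun ν => ?_⟩
  · exact (h1.comp (sn_diff u)).const_mul c
  · have := hb (sn t u)
    rw [Fin.prod_univ_castSucc] at this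
    simp only [sn, Fin.snoc_castSucc, Fin.snoc_last] at this
    rw [norm_mul]
    calc ‖c‖ * _ ≤ ‖c‖ * _ := mul_le_mul_of_nonneg_left this (norm_nonneg c)
      _ = _ := by ring
  · exact ⟨_, h3 ν.castSucc, (pder_slice h c u ν).symm⟩

theorem pder_line {n : ℕ} {g : (Fin (n + 1) → ℝ) → ℂ} (hg : Differentiable ℝ g)
    (t : Fin n → ℝ) (u : ℝ) :
    HasDerivAt (fun u => g (sn t u)) (pder (Fin.last n) g (sn t u)) u := by
  have e : (fun v : ℝ => g (Function.update (sn t u) (Fin.last n) v)) = fun v => g (sn t v) := by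
    funext v; simp [sn, Fin.update_snoc_last]
  simp only [pder, e]
  simp only [sn, Fin.snoc_last]
  exact ((hg.comp (sn_diff2 t)) u).hasDerivAt

theorem iter_slice {n : ℕ} (h : (Fin (n + 1) → ℝ) → ℂ) (c : ℂ) (u : ℝ) (ν : Fin n) (j : ℕ) :
    (pder ν)^[j] (fun t => c * h (sn t u)) = fun t => c * (pder ν.castSucc)^[j] h (sn t u) := by
  induction j generalizing h with
  | zero => rfl
  | succ j ih => rw [Function.iterate_succ_apply, pder_slice, ih, Function.iterate_succ_apply]

theorem multi_slice {n : ℕ} (g : (Fin (n + 1) → ℝ) → ℂ) (c : ℂ) (u : ℝ) (k : Fin (n + 1) → ℕ)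
    (t : Fin n → ℝ) :
    pderMulti (fun i => k i.castSucc)
      (fun t => c * ((pder (Fin.last n))^[k (Fin.last n)] g) (sn t u)) t =
    c * pderMulti k g (sn t u) := by
  have key : ∀ (l : List (Fin n)) (h : (Fin (n + 1) → ℝ) → ℂ),
      l.foldr (fun ν h => (pder ν)^[k ν.castSucc] h) (fun t => c * h (sn t u)) =
      fun t => c * ((l.map Fin.castSucc).foldr (fun ν h => (pder ν)^[k ν] h) h) (sn t u) := by
    intro l h
    induction l with
    | nil => rfl
    | cons a l ih => simp only [List.foldr_cons, List.map_cons, ih, iter_slice]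
  simp only [pderMulti]
  rw [key, List.finRange_succ_last, List.foldr_append]
  rfl

/-- multi-dimensional weight -/
def W {n : ℕ} (χ : Fin n → ℕ) (s : Fin n → ℂ) (t : Fin n → ℝ) : ℂ :=
  ∏ ν, wt (χ ν) (s ν) (t ν)

theorem W_meas {n : ℕ} (χ : Fin n → ℕ) (s : Fin n → ℂ) : Measurable (W χ s) := by
  unfold W
  exact Finset.measurable_fun_prod _ fun i _ => (wt_meas _ _).comp (measurable_pi_apply i)

theorem W_int {n : ℕ} (χ : Fin n → ℕ) (s : Fin n → ℂ) (hs : ∀ ν, 0 < (s ν).re) {c : ℝ}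
    (hc : 0 < c) :
    Integrable (fun t : Fin n → ℝ => (∏ i, Real.exp (-c * |t i|)) * ‖W χ s t‖) := by
  have := (Integrable.fintype_prod (μ := fun _ : Fin n => (volume : Measure ℝ))
    (fun i => wt_int hc (χ i) (hs i))).norm
  refine this.congr ?_
  filter_upwards with t
  rw [W, norm_prod, norm_prod, ← Finset.prod_mul_distrib]
  refine Finset.prod_congr rfl fun i _ => ?_
  rw [norm_mul, Complex.norm_real, Real.norm_of_nonneg (Real.exp_pos _).le]

theorem gW_int {n : ℕ} {g : (Fin n → ℝ) → ℂ} (hg : Continuous g) {C c : ℝ} (hc : 0 < c)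
    (hb : ∀ t, ‖g t‖ ≤ C * ∏ i, Real.exp (-c * |t i|))
    (χ : Fin n → ℕ) (s : Fin n → ℂ) (hs : ∀ ν, 0 < (s ν).re) :
    Integrable (fun t => g t * W χ s t) := by
  refine Integrable.mono' ((W_int χ s hs hc).const_mul C)
    (hg.aestronglyMeasurable.mul (W_meas χ s).aestronglyMeasurable) ?_
  filter_upwards with t
  rw [norm_mul, ← mul_assoc]
  exact mul_le_mul_of_nonneg_right (hb t) (norm_nonneg _)

theorem fub {n : ℕ} {f : (Fin (n + 1) → ℝ) → ℂ} (hf : Integrable f) :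
    ∫ t, f t = ∫ u : ℝ, ∫ t : Fin n → ℝ, f (sn t u) := by
  have mp := (volume_preserving_piFinSuccAbove (fun _ : Fin (n + 1) => ℝ) (Fin.last n)).symm
  have h1 := mp.integral_comp' f
  rw [← h1]
  have h2 := (mp.integrable_comp_emb (MeasurableEquiv.measurableEmbedding _)).2 hf
  rw [Measure.volume_eq_prod] at *
  refine (integral_prod _ h2).trans ?_
  refine integral_congr_ae ?_
  filter_upwards with u
  refine integral_congr_ae ?_
  filter_upwards with t
  simp [MeasurableEquiv.piFinSuccAbove, Fin.insertNthEquiv, sn]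

theorem main_gen : ∀ (n : ℕ) (g : (Fin n → ℝ) → ℂ) (_ : Nice g) (χ : Fin n → ℕ)
    (G : (Fin n → ℂ) → ℂ) (_ : Differentiable ℂ G)
    (_ : ∀ s : Fin n → ℂ, (∀ ν, 0 < (s ν).re) →
      G s = (∏ ν, GammaC (s ν))⁻¹ * ∫ t : Fin n → ℝ, g t * W χ s t) (k : Fin n → ℕ),
    G (fun ν => -(k ν : ℂ)) = (∏ ν, cst (χ ν) (k ν)) * pderMulti k g 0 := by
  intro n
  induction n with
  | zero =>
    intro g _ χ G _ hGL k
    rw [hGL _ (fun ν => ν.elim0)]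
    simp [W, pderMulti]
    rw [volume_pi, Measure.pi_of_empty, integral_dirac]
    exact congrArg g (Subsingleton.elim _ _)
  | succ n ih =>
    intro g hg χ G hG hGL k
    have hsn : ∀ z : ℂ, Differentiable ℂ (fun s : Fin n → ℂ => sn s z) := by
      intro z
      rw [differentiable_pi]
      intro i
      refine Fin.lastCases ?_ (fun i => ?_) i
      · simp [sn]
      · simp only [sn, Fin.snoc_castSucc]; fun_prop
    have hsn2 : ∀ s : Fin n → ℂ, Differentiable ℂ (fun z : ℂ => sn s z) := by
      intro z
      rw [differentiable_pi]
      intro i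
      refine Fin.lastCases ?_ (fun i => ?_) i
      · simp [sn]
      · simp [sn, Fin.snoc_castSucc]
    let L := Fin.last n
    let χ' : Fin n → ℕ := fun i => χ i.castSucc
    have step : ∀ s : Fin n → ℂ, (∀ ν, 0 < (s ν).re) →
        G (sn s (-(k L : ℂ))) = (∏ ν, GammaC (s ν))⁻¹ *
          ∫ t : Fin n → ℝ, (cst (χ L) (k L) * ((pder L)^[k L] g) (sn t 0)) * W χ' s t := by
      intro s hs
      let P : ℂ := (∏ ν, GammaC (s ν))⁻¹
      let f : ℕ → ℝ → ℂ := fun j u => P * ∫ t : Fin n → ℝ, ((pder L)^[j] g) (sn t u) * W χ' s t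
      have bd : ∀ j, ∃ C c : ℝ, 0 < c ∧ ∀ t u, ‖((pder L)^[j] g) (sn t u)‖ ≤
          (C * Real.exp (-c * |u|)) * ∏ i, Real.exp (-c * |t i|) := by
        intro j
        obtain ⟨C, c, hc, hb⟩ := (hg.iter L j).bound
        refine ⟨C, c, hc, fun t u => ?_⟩
        have := hb (sn t u)
        rw [Fin.prod_univ_castSucc] at this
        simp only [sn, Fin.snoc_castSucc, Fin.snoc_last] at this
        linarith
      have fint : ∀ j u, Integrable (fun t : Fin n → ℝ => ((pder L)^[j] g) (sn t u) * W χ' s t) := by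
        intro j u
        obtain ⟨C, c, hc, hb⟩ := bd j
        exact gW_int ((hg.iter L j).diff.continuous.comp (sn_diff u).continuous) hc
          (fun t => hb t u) χ' s hs
      have hd : ∀ j u, HasDerivAt (f j) (f (j + 1) u) u := by
        intro j u
        refine HasDerivAt.const_mul P ?_
        obtain ⟨C, c, hc, hb⟩ := bd (j + 1)
        refine (hasDerivAt_integral_of_dominated_loc_of_deriv_le
          (F := fun u (t : Fin n → ℝ) => ((pder L)^[j] g) (sn t u) * W χ' s t)
          (F' := fun u (t : Fin n → ℝ) => ((pder L)^[j + 1] g) (sn t u) * W χ' s t)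
          (bound := fun t => |C| * ((∏ i, Real.exp (-c * |t i|)) * ‖W χ' s t‖))
          (s := Set.univ) Filter.univ_mem
          (Filter.Eventually.of_forall fun v => (fint j v).aestronglyMeasurable)
          (fint j u) (fint (j + 1) u).aestronglyMeasurable ?_
          ((W_int χ' s hs hc).const_mul _) ?_).2
        · filter_upwards with t v _
          rw [norm_mul, ← mul_assoc]
          refine mul_le_mul_of_nonneg_right ((hb t v).trans ?_) (norm_nonneg _)
          refine mul_le_mul_of_nonneg_right ?_ (Finset.prod_nonneg fun i _ => (Real.exp_pos _).le)
          have h1 : Real.exp (-c * |v|) ≤ 1 := by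
            rw [Real.exp_le_one_iff]; nlinarith [abs_nonneg v]
          have h2 := Real.exp_pos (-c * |v|)
          nlinarith [le_abs_self C, abs_nonneg C]
        · filter_upwards with t v _
          rw [Function.iterate_succ_apply']
          exact (pder_line (hg.iter L j).diff t v).mul_const _
      have hb : ∀ j, ∃ C c : ℝ, 0 < c ∧ ∀ u, ‖f j u‖ ≤ C * Real.exp (-c * |u|) := by
        intro j
        obtain ⟨C, c, hc, hb⟩ := bd j
        refine ⟨‖P‖ * (C * ∫ t : Fin n → ℝ, (∏ i, Real.exp (-c * |t i|)) * ‖W χ' s t‖), c, hc,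
          fun u => ?_⟩
        simp only [f]
        rw [norm_mul, mul_assoc]
        refine mul_le_mul_of_nonneg_left ?_ (norm_nonneg _)
        calc _ ≤ ∫ t : Fin n → ℝ, (C * Real.exp (-c * |u|)) *
              ((∏ i, Real.exp (-c * |t i|)) * ‖W χ' s t‖) := by
              refine norm_integral_le_of_norm_le ((W_int χ' s hs hc).const_mul _) ?_
              filter_upwards with t
              rw [norm_mul, ← mul_assoc]
              exact mul_le_mul_of_nonneg_right (hb t u) (norm_nonneg _)
          _ = _ := by rw [integral_const_mul]; ring
      have := one_dim hd hb (E := fun z => G (sn s z)) (hG.comp (hsn2 s)) (χ L) (by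
        intro z hz
        have hpos : ∀ ν, 0 < ((sn s z) ν).re := by
          intro i
          refine Fin.lastCases ?_ (fun i => ?_) i
          · simpa [sn] using hz
          · simpa [sn, Fin.snoc_castSucc] using hs i
        rw [hGL _ hpos]
        obtain ⟨C, c, hc, hb⟩ := hg.bound
        rw [fub (gW_int hg.diff.continuous hc hb χ _ hpos), Fin.prod_univ_castSucc]
        simp only [sn, Fin.snoc_castSucc, Fin.snoc_last, f, Function.iterate_zero, id]
        rw [mul_inv, mul_comm _ (GammaC z)⁻¹, mul_assoc, ← integral_const_mul]
        congr 1
        refine integral_congr_ae ?_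
        filter_upwards with u
        rw [mul_assoc, ← integral_mul_const]
        congr 1
        refine integral_congr_ae ?_
        filter_upwards with t
        rw [W, Fin.prod_univ_castSucc]
        simp only [Fin.snoc_castSucc, Fin.snoc_last, W, χ', L]
        ring) (k L)
      rw [this]
      simp only [f, P]
      rw [mul_left_comm, ← integral_const_mul]
      congr 1
      refine integral_congr_ae ?_
      filter_upwards with t
      ring
    have hI := ih _ ((hg.iter L (k L)).slice (cst (χ L) (k L)) 0) χ'
      (fun s => G (sn s (-(k L : ℂ)))) (hG.comp (hsn _)) step (fun i => k i.castSucc)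
    rw [multi_slice] at hI
    have e1 : (fun ν => -(k ν : ℂ)) = sn (fun i : Fin n => -(k i.castSucc : ℂ)) (-(k L : ℂ)) := by
      funext i
      refine Fin.lastCases ?_ (fun i => ?_) i
      · simp [sn, L]
      · simp [sn, Fin.snoc_castSucc]
    have e2 : (sn (0 : Fin n → ℝ) 0) = 0 := by
      funext i
      refine Fin.lastCases ?_ (fun i => ?_) i
      · simp [sn]
      · simp [sn, Fin.snoc_castSucc]
    rw [e1, hI, e2, Fin.prod_univ_castSucc]
    ring

/-- the bounded factor `1/(1 - e(y+iu))` -/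
def psi (y u : ℝ) : ℂ := (1 - eC (y + Complex.I * u))⁻¹

theorem eC_split (y u : ℝ) :
    eC (y + Complex.I * u) = eC y * (Real.exp (-(2 * Real.pi * u)) : ℝ) := by
  rw [eC, eC, Complex.ofReal_exp, ← Complex.exp_add]
  congr 1
  push_cast
  linear_combination (2 * (Real.pi:ℂ) * u) * Complex.I_mul_I

theorem low_bd {y : ℝ} (hy : y ∈ Set.Ioo (0:ℝ) 1) : ∃ d : ℝ, 0 < d ∧ ∀ u : ℝ,
    d ≤ ‖1 - eC (y + Complex.I * u)‖ ∧
    d * Real.exp (-(2 * Real.pi * u)) ≤ ‖1 - eC (y + Complex.I * u)‖ := by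
  have hw : eC y = Real.cos (2 * Real.pi * y) + Real.sin (2 * Real.pi * y) * Complex.I := by
    rw [eC, Complex.ofReal_cos, Complex.ofReal_sin, ← Complex.exp_mul_I]
    congr 1; push_cast; ring
  set a := Real.cos (2 * Real.pi * y) with ha
  set b := Real.sin (2 * Real.pi * y) with hb
  have hab : a ^ 2 + b ^ 2 = 1 := by rw [ha, hb]; exact Real.cos_sq_add_sin_sq _
  have ha1 : a < 1 := by
    have h1 : a ≤ 1 := Real.cos_le_one _
    refine lt_of_le_of_ne h1 fun h => ?_
    rw [ha, Real.cos_eq_one_iff] at h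
    obtain ⟨m, hm⟩ := h
    have hp := Real.pi_pos
    have : (m:ℝ) = y := by
      have : (2 * Real.pi) * ((m:ℝ) - y) = 0 := by linarith
      rcases mul_eq_zero.1 this with h | h <;> linarith
    have h2 := hy.1
    have h3 := hy.2
    rw [← this] at h2 h3
    have h2' : 0 < m := by exact_mod_cast h2
    have h3' : m < 1 := by exact_mod_cast h3
    omega
  refine ⟨1 - max a 0, by simp [ha1], fun u => ?_⟩
  set ρ := Real.exp (-(2 * Real.pi * u)) with hρ
  have hρ0 : 0 < ρ := Real.exp_pos _
  have hn : ‖1 - eC (y + Complex.I * u)‖ ^ 2 = 1 - 2 * ρ * a + ρ ^ 2 := by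
    rw [eC_split, hw, ← hρ, ← Complex.normSq_eq_norm_sq, Complex.normSq_apply]
    clear_value ρ
    simp
    linear_combination ρ ^ 2 * hab
  have hm0 : 0 ≤ max a 0 := le_max_right _ _
  have hma : a ≤ max a 0 := le_max_left _ _
  have hm1 : max a 0 < 1 := by simp [ha1]
  set m := max a 0
  have h1 : (1 - m) * (1 + ρ ^ 2) ≤ ‖1 - eC (y + Complex.I * u)‖ ^ 2 := by
    rw [hn]
    nlinarith [mul_nonneg hρ0.le (sub_nonneg.2 hma), mul_nonneg hm0 (sq_nonneg (1 - ρ))]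
  have h2 : (1 - m) ^ 2 ≤ 1 - m := by nlinarith
  constructor
  · refine le_of_sq_le_sq ?_ (norm_nonneg _)
    nlinarith [mul_nonneg (sub_nonneg.2 hm1.le) (sq_nonneg ρ)]
  · refine le_of_sq_le_sq ?_ (norm_nonneg _)
    nlinarith [mul_le_mul_of_nonneg_right h2 (sq_nonneg ρ)]

theorem den_ne {y : ℝ} (hy : y ∈ Set.Ioo (0:ℝ) 1) (u : ℝ) : 1 - eC (y + Complex.I * u) ≠ 0 := by
  obtain ⟨d, hd, h⟩ := low_bd hy
  have := (h u).1
  exact norm_pos_iff.1 (by linarith)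

theorem psi_deriv {y : ℝ} (hy : y ∈ Set.Ioo (0:ℝ) 1) (u : ℝ) :
    HasDerivAt (psi y) (-2 * Real.pi * (psi y u * (psi y u - 1))) u := by
  have h0 := den_ne hy u
  have h1 : HasDerivAt (fun u : ℝ => 1 - eC (y + Complex.I * u))
      (2 * Real.pi * eC (y + Complex.I * u)) u := by
    unfold eC
    have h2 : HasDerivAt (fun u : ℝ => 2 * (Real.pi:ℂ) * Complex.I * (y + Complex.I * u))
        (-2 * Real.pi) u := by
      have := (((Complex.ofRealCLM.hasDerivAt (x := u)).const_mul Complex.I).const_add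
        (y:ℂ)).const_mul (2 * (Real.pi:ℂ) * Complex.I)
      refine this.congr_deriv ?_
      simp
      linear_combination (2 * (Real.pi:ℂ)) * Complex.I_mul_I
    refine (h2.cexp.const_sub 1).congr_deriv ?_
    ring
  refine (h1.inv h0).congr_deriv ?_
  rw [psi]
  field_simp
  ring

theorem phi_eq (u x y : ℝ) : phiF u x y = eC (Complex.I * u * x) * psi y u := by
  rw [phiF, psi, div_eq_mul_inv]

theorem phi_deriv {y : ℝ} (hy : y ∈ Set.Ioo (0:ℝ) 1) (x u : ℝ) :
    HasDerivAt (fun u => phiF u x y)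
      (phiF u x y * (-2 * Real.pi * x - 2 * Real.pi * (psi y u - 1))) u := by
  simp only [phi_eq]
  have h1 : HasDerivAt (fun u : ℝ => eC (Complex.I * u * x))
      (-2 * Real.pi * x * eC (Complex.I * u * x)) u := by
    unfold eC
    have h2 : HasDerivAt (fun u : ℝ => 2 * (Real.pi:ℂ) * Complex.I * (Complex.I * u * x))
        (-2 * Real.pi * x) u := by
      have := (((Complex.ofRealCLM.hasDerivAt (x := u)).const_mul Complex.I).mul_const
        (x:ℂ)).const_mul (2 * (Real.pi:ℂ) * Complex.I)
      refine this.congr_deriv ?_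
      simp
      linear_combination (2 * (Real.pi:ℂ) * x) * Complex.I_mul_I
    refine h2.cexp.congr_deriv ?_
    ring
  refine (h1.mul (psi_deriv hy u)).congr_deriv ?_
  ring

theorem psi_bd {y : ℝ} (hy : y ∈ Set.Ioo (0:ℝ) 1) : ∃ C : ℝ, ∀ u, ‖psi y u‖ ≤ C := by
  obtain ⟨d, hd, h⟩ := low_bd hy
  refine ⟨d⁻¹, fun u => ?_⟩
  rw [psi, norm_inv]
  exact inv_anti₀ hd (h u).1

theorem phi_bd {x y : ℝ} (hx : x ∈ Set.Ioo (0:ℝ) 1) (hy : y ∈ Set.Ioo (0:ℝ) 1) :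
    ∃ C c : ℝ, 0 < c ∧ ∀ u, ‖phiF u x y‖ ≤ C * Real.exp (-c * |u|) := by
  obtain ⟨d, hd, h⟩ := low_bd hy
  have hp := Real.pi_pos
  refine ⟨d⁻¹, 2 * Real.pi * min x (1 - x), ?_, fun u => ?_⟩
  · have : 0 < min x (1 - x) := lt_min hx.1 (by linarith [hx.2])
    positivity
  have e1 : ‖eC (Complex.I * u * x)‖ = Real.exp (-(2 * Real.pi * u * x)) := by
    rw [eC, Complex.norm_exp]
    congr 1
    simp [Complex.mul_re, Complex.mul_im]
    ring
  obtain ⟨h1, h2⟩ := h u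
  rw [phiF, norm_div, e1]
  have hN : 0 < ‖1 - eC (y + Complex.I * u)‖ := by linarith
  set N := ‖1 - eC (y + Complex.I * u)‖
  rw [div_le_iff₀ hN]
  rcases le_total 0 u with hu | hu
  · rw [abs_of_nonneg hu]
    have h3 : Real.exp (-(2 * Real.pi * u * x)) ≤
        Real.exp (-(2 * Real.pi * min x (1 - x)) * u) := by
      apply Real.exp_le_exp.2
      have := mul_le_mul_of_nonneg_left (min_le_left x (1 - x)) (mul_nonneg hp.le hu)
      nlinarith
    have h4 : 1 ≤ d⁻¹ * N := by
      rw [inv_mul_eq_div, le_div_iff₀ hd]; linarith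
    nlinarith [Real.exp_pos (-(2 * Real.pi * min x (1 - x)) * u)]
  · rw [abs_of_nonpos hu]
    have h3 : Real.exp (-(2 * Real.pi * u * x)) ≤
        Real.exp (-(2 * Real.pi * min x (1 - x)) * -u) * Real.exp (-(2 * Real.pi * u)) := by
      rw [← Real.exp_add]
      apply Real.exp_le_exp.2
      have := mul_le_mul_of_nonneg_left (min_le_right x (1 - x))
        (mul_nonneg hp.le (neg_nonneg.2 hu))
      nlinarith
    have h4 : Real.exp (-(2 * Real.pi * u)) ≤ d⁻¹ * N := by
      rw [inv_mul_eq_div, le_div_iff₀ hd]; linarith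
    nlinarith [Real.exp_pos (-(2 * Real.pi * min x (1 - x)) * -u)]

section
variable {r : ℕ} (A : Matrix (Fin r) (Fin r) ℝ) (x y : Fin r → ℝ)

/-- the coordinate functions generating the algebra of bounded factors -/
def psiA (μ : Fin r) : (Fin r → ℝ) → ℂ := fun t => psi (y μ) (Matrix.vecMul t A μ)

theorem vm_diff (μ : Fin r) : Differentiable ℝ (fun t : Fin r → ℝ => Matrix.vecMul t A μ) := by
  unfold Matrix.vecMul dotProduct
  fun_prop

theorem vm_line (t : Fin r → ℝ) (ν μ : Fin r) (u : ℝ) :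
    HasDerivAt (fun u => Matrix.vecMul (Function.update t ν u) A μ) (A ν μ) u := by
  have : (fun u => Matrix.vecMul (Function.update t ν u) A μ) =
      fun u => Matrix.vecMul t A μ + (u - t ν) * A ν μ := by
    funext u
    simp only [Matrix.vecMul, dotProduct]
    rw [← Finset.add_sum_erase _ _ (Finset.mem_univ ν),
      ← Finset.add_sum_erase (a := ν) _ (fun i => t i * A i μ) (Finset.mem_univ ν)]
    rw [Finset.sum_congr rfl (g := fun i => t i * A i μ)]
    · simp; ring
    · intro i hi
      rw [Function.update_of_ne (Finset.ne_of_mem_erase hi)]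
  rw [this]
  simpa using (((hasDerivAt_id u).sub_const (t ν)).mul_const (A ν μ)).const_add
    (Matrix.vecMul t A μ)

theorem upd_line {g : (Fin r → ℝ) → ℂ} (hg : Differentiable ℝ g) (ν : Fin r) (t : Fin r → ℝ) :
    HasDerivAt (fun u => g (Function.update t ν u)) (pder ν g t) (t ν) := by
  have : Differentiable ℝ (fun u : ℝ => Function.update t ν u) := fun u =>
    (hasDerivAt_update t ν u).differentiableAt
  exact ((hg.comp this) (t ν)).hasDerivAt

theorem pder_mul {g h : (Fin r → ℝ) → ℂ} (hg : Differentiable ℝ g) (hh : Differentiable ℝ h)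
    (ν : Fin r) : pder ν (g * h) = pder ν g * h + g * pder ν h := by
  funext t
  have := ((upd_line hg ν t).mul (upd_line hh ν t)).deriv
  simp only [Function.update_eq_self] at this
  exact this

theorem pder_add {g h : (Fin r → ℝ) → ℂ} (hg : Differentiable ℝ g) (hh : Differentiable ℝ h)
    (ν : Fin r) : pder ν (g + h) = pder ν g + pder ν h := by
  funext t
  exact ((upd_line hg ν t).add (upd_line hh ν t)).deriv

/-- the algebra of bounded factors -/
def QA : Subalgebra ℂ ((Fin r → ℝ) → ℂ) := Algebra.adjoin ℂ (Set.range (psiA A y))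

theorem psiA_mem (μ : Fin r) : psiA A y μ ∈ QA A y := Algebra.subset_adjoin ⟨μ, rfl⟩

theorem QA_prop (hy : ∀ ν, y ν ∈ Set.Ioo (0 : ℝ) 1) {q : (Fin r → ℝ) → ℂ} (hq : q ∈ QA A y) :
    Differentiable ℝ q ∧ (∃ C, ∀ t, ‖q t‖ ≤ C) ∧ ∀ ν, pder ν q ∈ QA A y := by
  refine Algebra.adjoin_induction (p := fun q _ => Differentiable ℝ q ∧ (∃ C, ∀ t, ‖q t‖ ≤ C) ∧
    ∀ ν, pder ν q ∈ QA A y) ?_ ?_ ?_ ?_ hq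
  · rintro _ ⟨μ, rfl⟩
    refine ⟨?_, ?_, ?_⟩
    · have : Differentiable ℝ (psi (y μ)) := fun u => (psi_deriv (hy μ) u).differentiableAt
      exact this.comp (vm_diff A μ)
    · obtain ⟨C, hC⟩ := psi_bd (hy μ)
      exact ⟨C, fun t => hC _⟩
    · intro ν
      have : pder ν (psiA A y μ) = (A ν μ * (-2 * Real.pi) : ℂ) •
          (psiA A y μ * (psiA A y μ - 1)) := by
        funext t
        have h := HasDerivAt.scomp (t ν) (psi_deriv (hy μ) _) (vm_line A t ν μ (t ν))
        have := h.deriv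
        simp only [Function.update_eq_self] at this
        refine Eq.trans this ?_
        simp [psiA]
        ring
      rw [this]
      exact (QA A y).smul_mem ((QA A y).mul_mem (psiA_mem A y μ)
        ((QA A y).sub_mem (psiA_mem A y μ) (QA A y).one_mem)) _
  · intro c
    refine ⟨?_, ⟨‖c‖, fun t => ?_⟩, fun ν => ?_⟩
    · exact differentiable_const c
    · simp
    · have : pder ν (algebraMap ℂ ((Fin r → ℝ) → ℂ) c) = 0 := by
        funext t
        simp [pder]
      rw [this]
      exact (QA A y).zero_mem
  · rintro f g hf hg ⟨f1, ⟨C, f2⟩, f3⟩ ⟨g1, ⟨D, g2⟩, g3⟩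
    refine ⟨f1.add g1, ⟨C + D, fun t => (norm_add_le _ _).trans (add_le_add (f2 t) (g2 t))⟩,
      fun ν => ?_⟩
    rw [pder_add f1 g1]
    exact (QA A y).add_mem (f3 ν) (g3 ν)
  · rintro f g hf hg ⟨f1, ⟨C, f2⟩, f3⟩ ⟨g1, ⟨D, g2⟩, g3⟩
    refine ⟨f1.mul g1, ⟨C * D, fun t => ?_⟩, fun ν => ?_⟩
    · rw [Pi.mul_apply, norm_mul]
      exact mul_le_mul (f2 t) (g2 t) (norm_nonneg _) ((norm_nonneg _).trans (f2 t))
    · rw [pder_mul f1 g1]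
      exact (QA A y).add_mem ((QA A y).mul_mem (f3 ν) hg) ((QA A y).mul_mem hf (g3 ν))

theorem FF_diff (hy : ∀ ν, y ν ∈ Set.Ioo (0 : ℝ) 1) :
    Differentiable ℝ (fun t => FF (Matrix.vecMul t A) x y) := by
  unfold FF
  have h : ∀ μ, Differentiable ℝ (fun t : Fin r → ℝ =>
      phiF (Matrix.vecMul t A μ) (x μ) (y μ)) := by
    intro μ
    have : Differentiable ℝ (fun u => phiF u (x μ) (y μ)) :=
      fun u => (phi_deriv (hy μ) (x μ) u).differentiableAt
    exact this.comp (vm_diff A μ)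
  intro t
  exact (HasFDerivAt.finsetProd (u := Finset.univ)
    (fun μ _ => (h μ t).hasFDerivAt)).differentiableAt

theorem FF_pder (hy : ∀ ν, y ν ∈ Set.Ioo (0 : ℝ) 1) (ν : Fin r) :
    ∃ q ∈ QA A y, pder ν (fun t => FF (Matrix.vecMul t A) x y) =
      (fun t => FF (Matrix.vecMul t A) x y) * q := by
  refine ⟨∑ μ, (A ν μ : ℂ) • ((-2 * Real.pi * x μ : ℂ) • (1 : (Fin r → ℝ) → ℂ) -
    (2 * Real.pi : ℂ) • (psiA A y μ - 1)), ?_, ?_⟩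
  · refine (QA A y).sum_mem fun μ _ => (QA A y).smul_mem ((QA A y).sub_mem
      ((QA A y).smul_mem (QA A y).one_mem _) ((QA A y).smul_mem
      ((QA A y).sub_mem (psiA_mem A y μ) (QA A y).one_mem) _)) _
  · funext t
    have h := HasDerivAt.fun_finsetProd (u := Finset.univ) (x := t ν)
      (f := fun μ u => phiF (Matrix.vecMul (Function.update t ν u) A μ) (x μ) (y μ))
      (fun μ _ => HasDerivAt.scomp (t ν) (phi_deriv (hy μ) (x μ) _) (vm_line A t ν μ (t ν)))
    have := h.deriv
    simp only [Function.update_eq_self] at this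
    refine Eq.trans this ?_
    simp only [Pi.mul_apply, Finset.sum_apply, Finset.mul_sum]
    refine Finset.sum_congr rfl fun μ _ => ?_
    rw [FF, ← Finset.prod_erase_mul _ _ (Finset.mem_univ μ)]
    simp [psiA]
    ring

theorem FF_bd (hA : A.det ≠ 0) (hx : ∀ ν, x ν ∈ Set.Ioo (0 : ℝ) 1)
    (hy : ∀ ν, y ν ∈ Set.Ioo (0 : ℝ) 1) :
    ∃ C c : ℝ, 0 < c ∧ ∀ t, ‖FF (Matrix.vecMul t A) x y‖ ≤ C * ∏ i, Real.exp (-c * |t i|) := by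
  choose C c hc hb using fun μ => phi_bd (hx μ) (hy μ)
  have hC : ∀ μ, 0 ≤ C μ := by
    intro μ
    have := (norm_nonneg _).trans (hb μ 0)
    simpa using this
  let K : Fin r → ℝ := fun μ => (∑ i, |A⁻¹ μ i|) / c μ
  have hK : ∀ μ, 0 ≤ K μ := fun μ =>
    div_nonneg (Finset.sum_nonneg fun i _ => abs_nonneg _) (hc μ).le
  let M : ℝ := 1 + ∑ μ, K μ
  have hM : 0 < M := by
    have := Finset.sum_nonneg fun μ (_ : μ ∈ Finset.univ) => hK μ
    simp only [M]; linarith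
  refine ⟨∏ μ, C μ, M⁻¹, inv_pos.2 hM, fun t => ?_⟩
  set v := Matrix.vecMul t A with hv
  have htv : t = Matrix.vecMul v A⁻¹ := by
    rw [hv, Matrix.vecMul_vecMul, Matrix.mul_nonsing_inv A (Ne.isUnit hA), Matrix.vecMul_one]
  have key : ∑ i, |t i| ≤ M * ∑ μ, c μ * |v μ| := by
    calc ∑ i, |t i| ≤ ∑ i, ∑ μ, |v μ| * |A⁻¹ μ i| := by
          refine Finset.sum_le_sum fun i _ => ?_
          conv_lhs => rw [htv]
          simp only [Matrix.vecMul, dotProduct]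
          refine (Finset.abs_sum_le_sum_abs _ _).trans (le_of_eq ?_)
          simp [abs_mul]
      _ = ∑ μ, K μ * (c μ * |v μ|) := by
          rw [Finset.sum_comm]
          refine Finset.sum_congr rfl fun μ _ => ?_
          rw [← Finset.mul_sum]
          simp only [K]
          have := (hc μ).ne'
          field_simp
      _ ≤ ∑ μ, M * (c μ * |v μ|) := by
          refine Finset.sum_le_sum fun μ _ => ?_
          refine mul_le_mul_of_nonneg_right ?_ (mul_nonneg (hc μ).le (abs_nonneg _))
          have := Finset.single_le_sum (f := K) (fun μ _ => hK μ) (Finset.mem_univ μ)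
          simp only [M]; linarith
      _ = _ := by rw [Finset.mul_sum]
  rw [FF, norm_prod]
  calc _ ≤ ∏ μ, (C μ * Real.exp (-c μ * |v μ|)) :=
        Finset.prod_le_prod (fun _ _ => norm_nonneg _) fun μ _ => hb μ _
    _ = (∏ μ, C μ) * Real.exp (∑ μ, (-c μ * |v μ|)) := by
        rw [Finset.prod_mul_distrib, Real.exp_sum]
    _ ≤ _ := by
        rw [← Real.exp_sum]
        refine mul_le_mul_of_nonneg_left (Real.exp_le_exp.2 ?_) (Finset.prod_nonneg fun μ _ => hC μ)
        simp only [neg_mul, Finset.sum_neg_distrib, ← Finset.mul_sum]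
        rw [neg_le_neg_iff, inv_mul_le_iff₀ hM]
        exact key

theorem FF_nice (hA : A.det ≠ 0) (hx : ∀ ν, x ν ∈ Set.Ioo (0 : ℝ) 1)
    (hy : ∀ ν, y ν ∈ Set.Ioo (0 : ℝ) 1) : Nice (fun t => FF (Matrix.vecMul t A) x y) := by
  set f : (Fin r → ℝ) → ℂ := fun t => FF (Matrix.vecMul t A) x y with hf
  refine ⟨(fun q => f * q) '' (QA A y : Set ((Fin r → ℝ) → ℂ)),
    ⟨1, (QA A y).one_mem, mul_one f⟩, ?_⟩
  rintro _ ⟨q, hq, rfl⟩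
  obtain ⟨q1, ⟨D, q2⟩, q3⟩ := QA_prop A y hy hq
  refine ⟨(FF_diff A x y hy).mul q1, ?_, ?_⟩
  · obtain ⟨C, c, hc, hb⟩ := FF_bd A x y hA hx hy
    refine ⟨C * D, c, hc, fun t => ?_⟩
    simp only [Pi.mul_apply]
    rw [norm_mul]
    calc _ ≤ (C * ∏ i, Real.exp (-c * |t i|)) * D :=
          mul_le_mul (hb t) (q2 t) (norm_nonneg _) ((norm_nonneg _).trans (hb t))
      _ = _ := by ring
  · intro ν
    obtain ⟨p, hp, he⟩ := FF_pder A x y hy ν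
    refine ⟨p * q + pder ν q, (QA A y).add_mem ((QA A y).mul_mem hp hq) (q3 ν), ?_⟩
    simp only
    rw [pder_mul (FF_diff A x y hy) q1, he]
    ring

end

theorem stmt_16 (r : ℕ) (hr : 1 ≤ r) (χ : Fin r → ℕ) (hχ : ∀ ν, χ ν ≤ 1)
    (A : Matrix (Fin r) (Fin r) ℝ) (hA : A.det ≠ 0) (x y : Fin r → ℝ)
    (hx : ∀ ν, x ν ∈ Set.Ioo (0 : ℝ) 1) (hy : ∀ ν, y ν ∈ Set.Ioo (0 : ℝ) 1)
    (G : (Fin r → ℂ) → ℂ) (hG : Differentiable ℂ G)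
    (hGL : ∀ s : Fin r → ℂ, (∀ ν, 0 < (s ν).re) → G s = ShintaniLchi χ s A x y)
    (k : Fin r → ℕ) :
    ((∀ ν, (k ν : ZMod 2) = 1 - (χ ν : ZMod 2)) →
      G (fun ν => -(k ν : ℂ)) = BkNum A x y k) ∧
    (¬ (∀ ν, (k ν : ZMod 2) = 1 - (χ ν : ZMod 2)) →
      G (fun ν => -(k ν : ℂ)) = 0) := by
  have key := main_gen r _ (FF_nice A x y hA hx hy) χ G hG (by
    intro s hs
    rw [hGL s hs, ShintaniLchi]
    congr 1
    refine integral_congr_ae ?_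
    filter_upwards with t
    rw [mul_assoc, qchar, ← Finset.prod_mul_distrib]
    rfl) k
  have par : ∀ ν, (k ν : ZMod 2) = 1 - (χ ν : ZMod 2) ↔ ¬ Even (χ ν + k ν) := by
    intro ν
    rw [← ZMod.natCast_eq_zero_iff_even]
    push_cast
    generalize (k ν : ZMod 2) = a
    generalize (χ ν : ZMod 2) = b
    revert a b
    decide
  constructor
  · intro h
    rw [key, BkNum]
    congr 1
    rw [← Finset.prod_pow_eq_pow_sum, ← Finset.prod_inv_distrib]
    refine Finset.prod_congr rfl fun ν _ => ?_
    have := Nat.not_even_iff_odd.1 ((par ν).1 (h ν))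
    rw [cst, this.neg_one_pow]
    norm_num
  · intro h
    push Not at h
    obtain ⟨ν, hν⟩ := h
    have he : Even (χ ν + k ν) := by
      by_contra hc
      exact hν ((par ν).2 hc)
    rw [key, Finset.prod_eq_zero (Finset.mem_univ ν), zero_mul]
    rw [cst, he.neg_one_pow]
    simp

end
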